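/- arXiv:1802.06266 — 3 statements merged into one kernel-verified Lean document; each statement's English description precedes it below -/
import Mathlib

section
/- Let φ ∈ C*(𝕋) with φ̂(1) ≠ 0, and let T be a trigonometric polynomial on 𝕋^q. Then ‖T − 𝔾_N(φ, T)‖ ≤ (4/|φ̂(1)|) E_N(1; φ) Σ_{k ∈ ℤ^q} |T̂(k)|, where the sum runs over the (finitely many) nonzero Fourier coefficients of T. -/
open MeasureTheory Real

noncomputable section

instance fact_two_pi_pos : Fact (0 < 2 * π) := ⟨by positivity⟩

/-- The `q`-dimensional torus `ℝ^q/(2πℤ)^q`, with the max metric. -/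
abbrev Torus (q : ℕ) := Fin q → AddCircle (2 * π)

/-- The exponential `x ↦ exp(i k·x)` on the torus. -/
def eK {q : ℕ} (k : Fin q → ℤ) : C(Torus q, ℂ) :=
  ⟨fun x => ∏ j, fourier (k j) (x j),
    continuous_finset_prod _ fun j _ => (map_continuous (fourier (k j))).comp (continuous_apply j)⟩

/-- The Euclidean norm `|k|₂` of a multi-integer. -/
def l2 {q : ℕ} (k : Fin q → ℤ) : ℝ := Real.sqrt (∑ j, ((k j : ℝ)) ^ 2)

/-- The space `H_n^q` of trigonometric polynomials of spherical degree `< n`. -/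
def trigSpan (q : ℕ) (n : ℝ) : Submodule ℂ C(Torus q, ℂ) :=
  Submodule.span ℂ {T | ∃ k : Fin q → ℤ, l2 k < n ∧ T = eK k}

/-- The degree of approximation `E_n(q; f)` in the supremum norm. -/
def degApprox (q : ℕ) (n : ℝ) (f : C(Torus q, ℂ)) : ℝ :=
  ⨅ T : ↥(trigSpan q n), ‖f - (T : C(Torus q, ℂ))‖

/-- The multivariate Fourier coefficient `f̂(k)`. -/
def mFourierCoeff {q : ℕ} (f : C(Torus q, ℂ)) (k : Fin q → ℤ) : ℂ :=
  (1 / ((2 * π : ℝ) : ℂ) ^ q) * ∫ x : Torus q, f x * (starRingEnd ℂ) (eK k x)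

/-- The box of frequencies used to write `Φ_N` and `σ_N` as finite sums. -/
def box (q : ℕ) (N : ℝ) : Finset (Fin q → ℤ) :=
  Finset.Icc (fun _ => -⌈N⌉) (fun _ => ⌈N⌉)

/-- The fixed smooth cutoff function `h`. -/
structure SmoothCutoff (h : ℝ → ℝ) : Prop where
  smooth : ContDiff ℝ (⊤ : ℕ∞) h
  even : ∀ t, h (-t) = h t
  nonneg : ∀ t, 0 ≤ h t
  le_one : ∀ t, h t ≤ 1
  eq_one : ∀ t, |t| ≤ 1 / 2 → h t = 1
  eq_zero : ∀ t, 1 ≤ |t| → h t = 0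

/-- The localized kernel `Φ_N(x) = Σ_k h(|k|₂/N) exp(i k·x)`. -/
def Phi (q : ℕ) (h : ℝ → ℝ) (N : ℝ) : C(Torus q, ℂ) :=
  ∑ k ∈ box q N, ((h (l2 k / N) : ℝ) : ℂ) • eK k

/-- The operator `σ_N(f)(x) = Σ_k h(|k|₂/N) f̂(k) exp(i k·x)`. -/
def sigmaOp (q : ℕ) (h : ℝ → ℝ) (N : ℝ) (f : C(Torus q, ℂ)) : C(Torus q, ℂ) :=
  ∑ k ∈ box q N, (((h (l2 k / N) : ℝ) : ℂ) * mFourierCoeff f k) • eK k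

/-- Minimal separation `η(C)` of the points of `C = {x_1, …, x_M}`. -/
def minSep {q M : ℕ} (x : Fin M → Torus q) : ℝ :=
  sInf {d | ∃ i j, x i ≠ x j ∧ d = dist (x i) (x j)}

/-- `x ↦ k·x` on the torus. -/
def dotk {q : ℕ} (k : Fin q → ℤ) : C(Torus q, AddCircle (2 * π)) :=
  ⟨fun x => ∑ j, k j • x j,
    continuous_finset_sum _ fun j _ => (continuous_zsmul (k j)).comp (continuous_apply j)⟩

/-- `x ↦ φ(k·x − t)`, a single neuron. -/
def transK {q : ℕ} (φ : C(AddCircle (2 * π), ℂ)) (k : Fin q → ℤ) (t : ℝ) : C(Torus q, ℂ) :=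
  φ.comp ⟨fun x => dotk k x - (t : AddCircle (2 * π)), (dotk k).continuous.sub continuous_const⟩

/-- The network `𝔾_Nt(φ, T)` associated with the trigonometric polynomial
`T = Σ_{k ∈ K} c k exp(i k ⬝ ·)`. -/
def Gop {q : ℕ} (φ : C(AddCircle (2 * π), ℂ)) (Nt : ℕ) (K : Finset (Fin q → ℤ))
    (c : (Fin q → ℤ) → ℂ) : C(Torus q, ℂ) :=
  (1 / (((2 * Nt + 1 : ℕ) : ℂ) * fourierCoeff (⇑φ) 1)) •
    ∑ j ∈ Finset.range (2 * Nt + 1),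
      Complex.exp (2 * (π : ℂ) * Complex.I * (j : ℂ) / ((2 * Nt + 1 : ℕ) : ℂ)) •
        ∑ k ∈ K, c k • transK φ k (2 * π * (j : ℝ) / ((2 * Nt + 1 : ℕ) : ℝ))

/-- The network `𝔾_Nt(φ, Φ_N)`. -/
def GPhiOp (q : ℕ) (h : ℝ → ℝ) (φ : C(AddCircle (2 * π), ℂ)) (Nt : ℕ) (N : ℝ) :
    C(Torus q, ℂ) :=
  Gop φ Nt (box q N) fun k => ((h (l2 k / N) : ℝ) : ℂ)

/-- The network `𝔾_Nt(φ, σ_n(f))`. -/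
def GsigmaOp (q : ℕ) (h : ℝ → ℝ) (φ : C(AddCircle (2 * π), ℂ)) (Nt : ℕ) (n : ℝ)
    (f : C(Torus q, ℂ)) : C(Torus q, ℂ) :=
  Gop φ Nt (box q n) fun k => ((h (l2 k / n) : ℝ) : ℂ) * mFourierCoeff f k

/-- Univariate trigonometric polynomials of degree `< n`. -/
def trigSpan1 (n : ℝ) : Submodule ℂ C(AddCircle (2 * π), ℂ) :=
  Submodule.span ℂ {T | ∃ k : ℤ, |(k : ℝ)| < n ∧ T = fourier k}

/-- The univariate degree of approximation `E_n(1; φ)`. -/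
def degApprox1 (n : ℝ) (φ : C(AddCircle (2 * π), ℂ)) : ℝ :=
  ⨅ T : ↥(trigSpan1 n), ‖φ - (T : C(AddCircle (2 * π), ℂ))‖

/-- Univariate trigonometric polynomials of degree `≤ m`. -/
def trigSpanLe1 (m : ℝ) : Submodule ℂ C(AddCircle (2 * π), ℂ) :=
  Submodule.span ℂ {T | ∃ k : ℤ, |(k : ℝ)| ≤ m ∧ T = fourier k}

/-- The degree of approximation by univariate trigonometric polynomials of degree `≤ m`. -/
def degApproxLe1 (m : ℝ) (φ : C(AddCircle (2 * π), ℂ)) : ℝ :=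
  ⨅ T : ↥(trigSpanLe1 m), ‖φ - (T : C(AddCircle (2 * π), ℂ))‖

/-- Projection of `ℝ^q` onto the torus. -/
def projT {q : ℕ} (x : Fin q → ℝ) : Torus q := fun j => (x j : AddCircle (2 * π))

/-- The `2π`-periodic lift to `ℝ^q` of a function on the torus. -/
def liftT {q : ℕ} (f : C(Torus q, ℂ)) : (Fin q → ℝ) → ℂ := fun x => f (projT x)

/-- `f ∈ W*(𝕋^q)`: `f` is continuously differentiable. -/
def MemW {q : ℕ} (f : C(Torus q, ℂ)) : Prop := ContDiff ℝ 1 (liftT f)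

/-- The `W*` seminorm `Σ_j ‖D_j f‖`. -/
def Wnorm {q : ℕ} (f : C(Torus q, ℂ)) : ℝ :=
  ∑ j, ⨆ x : Fin q → ℝ, ‖fderiv ℝ (liftT f) x (Pi.single j 1)‖

/-- Degree of approximation of a (not necessarily continuous) periodic function on `ℝ^q`. -/
def degApprox' (q : ℕ) (n : ℝ) (g : (Fin q → ℝ) → ℂ) : ℝ :=
  ⨅ T : ↥(trigSpan q n), ⨆ x : Fin q → ℝ, ‖g x - (T : C(Torus q, ℂ)) (projT x)‖

/-- Degree of approximation of a (not necessarily continuous) `2π`-periodic function on `ℝ`. -/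
def degApprox1' (n : ℝ) (g : ℝ → ℂ) : ℝ :=
  ⨅ T : ↥(trigSpan1 n), ⨆ t : ℝ, ‖g t - (T : C(AddCircle (2 * π), ℂ)) (t : AddCircle (2 * π))‖

/-- The regularization functional `R_N(T)`. -/
def regFunc {q M : ℕ} (N : ℝ) (x : Fin M → Torus q) (y : Fin M → ℂ) (T : C(Torus q, ℂ)) : ℝ :=
  (⨆ j, ‖y j - T (x j)‖) + (1 / N) * Wnorm T

/-- Translate of a function on the torus. -/
def translateC {q : ℕ} (g : C(Torus q, ℂ)) (z : Torus q) : C(Torus q, ℂ) :=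
  g.comp ⟨fun w => w - z, continuous_id.sub continuous_const⟩

/-- The interpolant `T^#_N(D) = σ_N(f) + Σ_j a_j Φ_N(· − x_j)`. -/
def interpolant {q M : ℕ} (h : ℝ → ℝ) (N : ℝ) (f : C(Torus q, ℂ)) (x : Fin M → Torus q)
    (a : Fin M → ℂ) : C(Torus q, ℂ) :=
  sigmaOp q h N f + ∑ j, a j • translateC (Phi q h N) (x j)

end
/-- Orthonormality of the exponentials on the torus. -/
theorem mFourierCoeff_eK {q : ℕ} (k l : Fin q → ℤ) :
    mFourierCoeff (eK k) l = if k = l then 1 else 0 := by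
  have one_dim (m n : ℤ) :
      ∫ x : AddCircle (2 * π), (fourier m x : ℂ) * (starRingEnd ℂ) (fourier n x) =
        ((2 * π : ℝ) : ℂ) * if m = n then 1 else 0 := by
    have h := congrFun (fourierCoeff_fourier (T := 2 * π) m) n
    rw [fourierCoeff, AddCircle.integral_haarAddCircle, inv_smul_eq_iff₀ two_pi_pos.ne'] at h
    simp only [← fourier_neg, mul_comm (fourier m _)]
    simp only [smul_eq_mul] at h
    rw [h, Pi.single_apply, Complex.real_smul]
    simp only [eq_comm]
  have prod_form : (∫ x : Torus q, eK k x * (starRingEnd ℂ) (eK l x)) =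
      ∏ j, ∫ x : AddCircle (2 * π),
        (fourier (k j) x : ℂ) * (starRingEnd ℂ) (fourier (l j) x) := by
    rw [← integral_fintype_prod_volume_eq_prod
      (f := fun j (x : AddCircle (2 * π)) =>
        (fourier (k j) x : ℂ) * (starRingEnd ℂ) (fourier (l j) x))]
    simp only [eK, ContinuousMap.coe_mk, map_prod, Finset.prod_mul_distrib]
  have hpi : ((2 * π : ℝ) : ℂ) ≠ 0 := Complex.ofReal_ne_zero.mpr two_pi_pos.ne'
  rw [mFourierCoeff, prod_form]
  simp only [one_dim, Finset.prod_mul_distrib, Finset.prod_const, Finset.card_univ,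
    Fintype.card_fin]
  rw [← mul_assoc, one_div_mul_cancel (pow_ne_zero _ hpi), one_mul, Fintype.prod_ite_zero]
  simp [funext_iff]

theorem integrable_torus {q : ℕ} (f : C(Torus q, ℂ)) : Integrable (⇑f) :=
  f.continuous.integrable_of_hasCompactSupport (HasCompactSupport.of_compactSpace _)

/-- The Fourier coefficients of a trigonometric polynomial are its coefficients. -/
theorem mFourierCoeff_sum_eK {q : ℕ} (K : Finset (Fin q → ℤ)) (c : (Fin q → ℤ) → ℂ)
    {l : Fin q → ℤ} (hl : l ∈ K) : mFourierCoeff (∑ k ∈ K, c k • eK k) l = c l := by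
  have expand : mFourierCoeff (∑ k ∈ K, c k • eK k) l =
      ∑ k ∈ K, c k * mFourierCoeff (eK k) l := by
    simp only [mFourierCoeff, ContinuousMap.coe_sum, Finset.sum_apply, ContinuousMap.coe_smul,
      Pi.smul_apply, smul_eq_mul, Finset.sum_mul, mul_assoc]
    rw [integral_finsetSum, Finset.mul_sum]
    · refine Finset.sum_congr rfl fun k _ => ?_
      rw [integral_const_mul]
      ring
    · intro k _
      exact (integrable_torus (eK k * star (eK l))).const_mul (c k)
  rw [expand]
  simp [mFourierCoeff_eK, hl]

theorem fourier_sub_apply {T : ℝ} (n : ℤ) (x y : AddCircle T) :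
    (fourier n (x - y) : ℂ) = fourier n x * fourier (-n) y := by
  rw [fourier_apply, fourier_apply, fourier_apply, zsmul_sub, neg_zsmul, sub_eq_add_neg,
    AddCircle.toCircle_add, Circle.coe_mul]

theorem fourier_dotk {q : ℕ} (k : Fin q → ℤ) (x : Torus q) :
    (fourier 1 (dotk k x) : ℂ) = eK k x := by
  have toCircle_sum (s : Finset (Fin q)) :
      (AddCircle.toCircle (∑ j ∈ s, k j • x j) : ℂ) = ∏ j ∈ s, fourier (k j) (x j) := by
    induction s using Finset.cons_induction with
    | empty => simp
    | cons a s ha ih =>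
      rw [Finset.sum_cons, Finset.prod_cons, AddCircle.toCircle_add, Circle.coe_mul, ih,
        fourier_apply]
  rw [fourier_one]
  exact toCircle_sum Finset.univ

/-- The discrete Fourier quadrature
`(2N+1)⁻¹ ∑ⱼ exp(2πij/(2N+1)) φ(y − 2πj/(2N+1))` of the first Fourier mode of `φ`. -/
noncomputable def quadrature (N : ℕ) (φ : C(AddCircle (2 * π), ℂ)) (y : AddCircle (2 * π)) : ℂ :=
  (1 / ((2 * N + 1 : ℕ) : ℂ)) * ∑ j ∈ Finset.range (2 * N + 1),
    Complex.exp (2 * (π : ℂ) * Complex.I * (j : ℂ) / ((2 * N + 1 : ℕ) : ℂ)) *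
      φ (y - ((2 * π * (j : ℝ) / ((2 * N + 1 : ℕ) : ℝ) : ℝ) : AddCircle (2 * π)))

theorem quadrature_add (N : ℕ) (φ ψ : C(AddCircle (2 * π), ℂ)) (y : AddCircle (2 * π)) :
    quadrature N (φ + ψ) y = quadrature N φ y + quadrature N ψ y := by
  simp only [quadrature, ContinuousMap.add_apply, mul_add, Finset.sum_add_distrib]

theorem quadrature_smul (N : ℕ) (c : ℂ) (φ : C(AddCircle (2 * π), ℂ)) (y : AddCircle (2 * π)) :
    quadrature N (c • φ) y = c * quadrature N φ y := by
  simp only [quadrature, ContinuousMap.smul_apply, smul_eq_mul, Finset.mul_sum]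
  exact Finset.sum_congr rfl fun j _ => by ring

theorem norm_quadrature_le (N : ℕ) (φ : C(AddCircle (2 * π), ℂ)) (y : AddCircle (2 * π)) :
    ‖quadrature N φ y‖ ≤ ‖φ‖ := by
  have term_le (j : ℕ) :
      ‖Complex.exp (2 * (π : ℂ) * Complex.I * (j : ℂ) / ((2 * N + 1 : ℕ) : ℂ)) *
        φ (y - ((2 * π * (j : ℝ) / ((2 * N + 1 : ℕ) : ℝ) : ℝ) : AddCircle (2 * π)))‖ ≤ ‖φ‖ := by
    have h : 2 * (π : ℂ) * Complex.I * (j : ℂ) / ((2 * N + 1 : ℕ) : ℂ) =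
        ((2 * π * j / (2 * N + 1 : ℕ) : ℝ) : ℂ) * Complex.I := by
      push_cast
      ring
    rw [h, norm_mul, Complex.norm_exp_ofReal_mul_I, one_mul]
    exact φ.norm_coe_le_norm _
  have hM : (0 : ℝ) < (2 * N + 1 : ℕ) := by positivity
  rw [quadrature, norm_mul, norm_div, norm_one, Complex.norm_natCast, one_div,
    inv_mul_le_iff₀ hM]
  refine (norm_sum_le_of_le _ fun j _ => term_le j).trans_eq ?_
  rw [Finset.sum_const, Finset.card_range, nsmul_eq_mul]

/-- The quadrature is exact on the exponentials of degree less than `N`. -/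
theorem quadrature_fourier {N : ℕ} {k : ℤ} (hk : |k| < N) (y : AddCircle (2 * π)) :
    quadrature N (fourier k) y = (if k = 1 then 1 else 0) * fourier 1 y := by
  have hM : ((2 * N + 1 : ℕ) : ℂ) ≠ 0 := Nat.cast_ne_zero.mpr (Nat.succ_ne_zero _)
  have hpi : (π : ℂ) ≠ 0 := Complex.ofReal_ne_zero.mpr pi_ne_zero
  set ζ : ℂ := Complex.exp (2 * π * Complex.I * ((1 - k : ℤ) : ℂ) / ((2 * N + 1 : ℕ) : ℂ)) with hζ
  have term_eq (j : ℕ) :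
      Complex.exp (2 * (π : ℂ) * Complex.I * (j : ℂ) / ((2 * N + 1 : ℕ) : ℂ)) *
        fourier k (y - ((2 * π * (j : ℝ) / ((2 * N + 1 : ℕ) : ℝ) : ℝ) : AddCircle (2 * π))) =
      fourier k y * ζ ^ j := by
    rw [fourier_sub_apply, fourier_coe_apply, hζ, ← Complex.exp_nat_mul, mul_left_comm,
      ← Complex.exp_add]
    congr 2
    push_cast
    field_simp
    ring
  have pow_eq : ζ ^ (2 * N + 1) = 1 := by
    rw [hζ, ← Complex.exp_nat_mul, Complex.exp_eq_one_iff]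
    exact ⟨1 - k, by field_simp⟩
  simp only [quadrature, term_eq, ← Finset.mul_sum]
  split_ifs with h
  · have : ζ = 1 := by simp [hζ, h]
    subst h
    simp only [this, one_pow, Finset.sum_const, Finset.card_range, nsmul_eq_mul]
    field_simp
  · have ζ_ne : ζ ≠ 1 := by
      rw [hζ, Ne, Complex.exp_eq_one_iff]
      rintro ⟨n, hn⟩
      have hcast : ((1 - k : ℤ) : ℂ) = ((n * (2 * N + 1 : ℕ) : ℤ) : ℂ) := by
        have hI := Complex.I_ne_zero
        field_simp at hn
        push_cast at hn ⊢
        linear_combination hn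
      have hdvd : ((2 * N + 1 : ℕ) : ℤ) ∣ 1 - k := ⟨n, by rw [Int.cast_inj.mp hcast, mul_comm]⟩
      have := Int.eq_zero_of_abs_lt_dvd hdvd (by rw [abs_lt] at hk ⊢; push_cast; omega)
      omega
    rw [geom_sum_eq ζ_ne, pow_eq]
    simp

theorem integrable_circle (φ : C(AddCircle (2 * π), ℂ)) :
    Integrable (⇑φ) AddCircle.haarAddCircle :=
  φ.continuous.integrable_of_hasCompactSupport (HasCompactSupport.of_compactSpace _)

theorem fourierCoeff_add_apply (φ ψ : C(AddCircle (2 * π), ℂ)) (n : ℤ) :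
    fourierCoeff (⇑(φ + ψ)) n = fourierCoeff (⇑φ) n + fourierCoeff (⇑ψ) n :=
  congrFun (fourierCoeff.add (integrable_circle φ) (integrable_circle ψ)) n

/-- The quadrature is exact on trigonometric polynomials of degree less than `N`. -/
theorem quadrature_of_mem_trigSpan1 {N : ℕ} {P : C(AddCircle (2 * π), ℂ)}
    (hP : P ∈ trigSpan1 N) (y : AddCircle (2 * π)) :
    quadrature N P y = fourierCoeff (⇑P) 1 * fourier 1 y := by
  induction hP using Submodule.span_induction with
  | mem P hP =>
    obtain ⟨k, hk, rfl⟩ := hP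
    rw [quadrature_fourier (by exact_mod_cast hk), fourierCoeff_fourier, Pi.single_apply]
    simp only [eq_comm]
  | zero => simp [quadrature, fourierCoeff]
  | add P Q _ _ hP hQ => rw [quadrature_add, fourierCoeff_add_apply, hP, hQ, add_mul]
  | smul c P _ hP =>
    rw [quadrature_smul, hP, ContinuousMap.coe_smul, fourierCoeff.const_smul, smul_eq_mul,
      mul_assoc]

theorem norm_fourierCoeff_le (φ : C(AddCircle (2 * π), ℂ)) (n : ℤ) :
    ‖fourierCoeff (⇑φ) n‖ ≤ ‖φ‖ := by
  refine (norm_integral_le_of_norm_le_const (C := ‖φ‖) (ae_of_all _ fun t => ?_)).trans_eq ?_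
  · rw [norm_smul, fourier_apply, Circle.norm_coe, one_mul]
    exact φ.norm_coe_le_norm t
  · simp

theorem norm_fourierCoeff_mul_sub_quadrature_le (N : ℕ) (φ : C(AddCircle (2 * π), ℂ))
    (y : AddCircle (2 * π)) :
    ‖fourierCoeff (⇑φ) 1 * fourier 1 y - quadrature N φ y‖ ≤ 2 * degApprox1 N φ := by
  rw [← div_le_iff₀' two_pos]
  refine le_ciInf fun P => ?_
  rw [div_le_iff₀' two_pos, two_mul ‖_‖]
  obtain ⟨ψ, rfl⟩ : ∃ ψ, φ = ψ + (P : C(AddCircle (2 * π), ℂ)) := ⟨φ - P, by simp⟩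
  rw [quadrature_add, quadrature_of_mem_trigSpan1 P.2, fourierCoeff_add_apply, add_mul,
    add_sub_add_right_eq_sub, add_sub_cancel_right]
  refine (norm_sub_le _ _).trans (add_le_add ?_ (norm_quadrature_le N ψ y))
  rw [norm_mul, fourier_apply, Circle.norm_coe, mul_one]
  exact norm_fourierCoeff_le ψ 1

theorem degApprox1_nonneg (n : ℝ) (φ : C(AddCircle (2 * π), ℂ)) : 0 ≤ degApprox1 n φ :=
  Real.iInf_nonneg fun _ => norm_nonneg _

theorem Gop_apply {q : ℕ} (φ : C(AddCircle (2 * π), ℂ)) (N : ℕ) (K : Finset (Fin q → ℤ))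
    (c : (Fin q → ℤ) → ℂ) (x : Torus q) :
    Gop φ N K c x =
      ∑ k ∈ K, c k * ((fourierCoeff (⇑φ) 1)⁻¹ * quadrature N φ (dotk k x)) := by
  simp only [Gop, quadrature, transK, ContinuousMap.smul_apply, ContinuousMap.sum_apply,
    ContinuousMap.comp_apply, ContinuousMap.coe_mk, smul_eq_mul, Finset.mul_sum]
  rw [Finset.sum_comm]
  refine Finset.sum_congr rfl fun k _ => Finset.sum_congr rfl fun j _ => ?_
  rw [one_div, one_div, mul_inv]
  ring

/-- a trigonometric polynomial `T` on `𝕋^q` is approximated in the uniform norm by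
the network `𝔾_N(φ, T)`, with error `(4/|φ̂(1)|) E_N(1; φ) Σ_k |T̂(k)|`. -/
theorem trigpoly_approx_by_network (q : ℕ) (φ : C(AddCircle (2 * π), ℂ))
    (hφ : fourierCoeff (⇑φ) 1 ≠ 0) (N : ℕ) (hN : 1 ≤ N)
    (K : Finset (Fin q → ℤ)) (T : C(Torus q, ℂ))
    (hT : ∃ c : (Fin q → ℤ) → ℂ, T = ∑ k ∈ K, c k • eK k) :
    ‖T - Gop φ N K (mFourierCoeff T)‖
      ≤ 4 / ‖fourierCoeff (⇑φ) 1‖ * degApprox1 (N : ℝ) φ * ∑ k ∈ K, ‖mFourierCoeff T k‖ := by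
  obtain ⟨c, hc⟩ := hT
  have T_apply (x : Torus q) : T x = ∑ k ∈ K, mFourierCoeff T k * fourier 1 (dotk k x) := by
    conv_lhs => rw [hc]
    simp only [ContinuousMap.sum_apply, ContinuousMap.smul_apply, smul_eq_mul]
    refine Finset.sum_congr rfl fun k hk => ?_
    rw [fourier_dotk, hc, mFourierCoeff_sum_eK K c hk]
  have hE := degApprox1_nonneg N φ
  rw [ContinuousMap.norm_le _ (by positivity)]
  intro x
  rw [ContinuousMap.sub_apply, T_apply, Gop_apply, ← Finset.sum_sub_distrib, Finset.mul_sum]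
  refine norm_sum_le_of_le _ fun k _ => ?_
  have factor : mFourierCoeff T k * fourier 1 (dotk k x) -
      mFourierCoeff T k * ((fourierCoeff (⇑φ) 1)⁻¹ * quadrature N φ (dotk k x)) =
      mFourierCoeff T k * ((fourierCoeff (⇑φ) 1)⁻¹ *
        (fourierCoeff (⇑φ) 1 * fourier 1 (dotk k x) - quadrature N φ (dotk k x))) := by
    rw [mul_sub (fourierCoeff (⇑φ) 1)⁻¹, inv_mul_cancel_left₀ hφ, mul_sub]
  rw [factor, norm_mul, norm_mul, norm_inv, mul_comm]
  refine mul_le_mul_of_nonneg_right ?_ (norm_nonneg _)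
  rw [div_eq_inv_mul, mul_assoc]
  refine mul_le_mul_of_nonneg_left ?_ (by positivity)
  linarith [norm_fourierCoeff_mul_sub_quadrature_le N φ (dotk k x)]
end

section
/- Let f ∈ W*(𝕋^q), B as in the interpolation theorem, N ≥ B η(C)^{-1}, and T*(D) = argmin_{T ∈ H_N^q} R_N(T), where R_N(T) = max_{1≤j≤M} |y_j − T(x_j)| + (1/N)‖T‖_{W*}. Then for every x ∈ 𝕋^q, with δ = min_{1≤j≤M} |x − x_j|, one has |f(x) − T*(D)(x)| ≤ c (1 + Nδ) { ε + (1/N) ‖f‖_{W*} }, where c depends only on q, h, S (good pointwise generalization error). -/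
open MeasureTheory Real

theorem integral_fourier_haarAddCircle {T : ℝ} [hT : Fact (0 < T)] (n : ℤ) :
    ∫ t : AddCircle T, fourier n t ∂AddCircle.haarAddCircle = if n = 0 then 1 else 0 := by
  split_ifs with hn
  · subst hn
    simp
  · exact integral_eq_zero_of_add_right_eq_neg (fourier_add_half_inv_index hn hT.elim)

theorem integrable_haarAddCircle {E : Type*} [NormedAddCommGroup E] {f : AddCircle (2 * π) → E}
    (hf : Continuous f) : Integrable f AddCircle.haarAddCircle :=
  hf.integrable_of_hasCompactSupport (HasCompactSupport.of_compactSpace f)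

/-- Every point of the circle has a representative of minimal absolute value. -/
theorem exists_coe_eq_abs_eq_norm {p : ℝ} (t : AddCircle p) :
    ∃ s : ℝ, (s : AddCircle p) = t ∧ |s| = ‖t‖ := by
  obtain ⟨s, rfl⟩ := QuotientAddGroup.mk_surjective t
  refine ⟨s - round (p⁻¹ * s) * p, ?_, (AddCircle.norm_eq _).symm⟩
  rw [AddCircle.coe_sub, ← zsmul_eq_mul, AddCircle.coe_zsmul, AddCircle.coe_period]
  simp

/-- On the circle of length `2π`, the norm is controlled by `sin²(t/2)`. -/
theorem norm_sq_le_one_sub_re_fourier (t : AddCircle (2 * π)) :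
    ‖t‖ ^ 2 ≤ π ^ 2 / 2 * (1 - (fourier 1 t).re) := by
  obtain ⟨s, rfl, hs⟩ := exists_coe_eq_abs_eq_norm t
  have hle : ‖(s : AddCircle (2 * π))‖ ≤ |2 * π| / 2 :=
    AddCircle.norm_le_half_period _ (by positivity)
  rw [abs_of_pos (by positivity)] at hle
  have hre : (fourier 1 (s : AddCircle (2 * π))).re = Real.cos s := by
    rw [fourier_coe_apply, ← Complex.exp_ofReal_mul_I_re]
    congr 2
    push_cast
    have : (π : ℂ) ≠ 0 := by exact_mod_cast Real.pi_ne_zero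
    field_simp
  have hsin := Real.mul_abs_le_abs_sin (x := s / 2) (by
    rw [abs_div, abs_two, hs]; linarith)
  have h1 : Real.cos s = 1 - 2 * Real.sin (s / 2) ^ 2 := by
    have h2 := Real.cos_sq' (s / 2)
    have h3 := Real.cos_two_mul (s / 2)
    rw [mul_div_cancel₀ s two_ne_zero] at h3
    linarith
  rw [hre, h1, ← hs, sq_abs]
  have h2 : (2 / π * |s / 2|) ^ 2 ≤ |Real.sin (s / 2)| ^ 2 := by gcongr
  rw [mul_pow, sq_abs, sq_abs] at h2
  have h3 : s ^ 2 = π ^ 2 * ((2 / π) ^ 2 * (s / 2) ^ 2) := by field_simp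
  rw [h3]
  nlinarith [sq_nonneg π]

/-- The Fejér–Korovkin weights are an approximate eigenvector of the shift. -/
theorem sum_sin_mul_sin_succ (n : ℕ) {θ : ℝ} (hθ : Real.sin ((n + 1) * θ) = 0) :
    ∑ k ∈ Finset.range n, Real.sin ((k + 1) * θ) * Real.sin ((k + 2) * θ)
      = Real.cos θ * ∑ k ∈ Finset.range n, Real.sin ((k + 1) * θ) ^ 2 := by
  have htel := Finset.sum_range_sub
    (fun k : ℕ => Real.sin (k * θ) * Real.sin ((k + 1) * θ)) n
  have hstep : ∀ k : ℕ, 2 * (Real.sin ((k + 1) * θ) * Real.sin ((k + 2) * θ))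
      = 2 * (Real.cos θ * Real.sin ((k + 1) * θ) ^ 2) +
        (Real.sin ((k + 1 : ℕ) * θ) * Real.sin (((k + 1 : ℕ) + 1) * θ)
          - Real.sin (k * θ) * Real.sin ((k + 1) * θ)) := by
    intro k
    have h1 : ((k : ℝ) + 2) * θ = (k + 1) * θ + θ := by ring
    have h2 : (k : ℝ) * θ = (k + 1) * θ - θ := by ring
    have h3 : (((k + 1 : ℕ) : ℝ) + 1) * θ = (k + 1) * θ + θ := by push_cast; ring
    rw [h3, h1, h2, Real.sin_add, Real.sin_sub]
    push_cast
    ring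
  have h := Finset.sum_congr rfl (fun k (_ : k ∈ Finset.range n) => hstep k)
  rw [Finset.sum_add_distrib, htel, ← Finset.mul_sum, ← Finset.mul_sum, ← Finset.mul_sum] at h
  simp only [hθ, Nat.cast_zero, zero_mul, Real.sin_zero, mul_zero, sub_zero, add_zero] at h
  linarith

/-- The Fejér–Korovkin kernel: a nonnegative trigonometric polynomial of degree `n - 1` of
mean one, with first Fourier coefficient `cos (π / (n + 1))`. -/
theorem exists_fejerKorovkin_kernel (n : ℕ) (hn : 0 < n) :
    ∃ (K : AddCircle (2 * π) → ℝ) (c : Fin n × Fin n → ℂ), Continuous K ∧ (∀ t, 0 ≤ K t) ∧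
      (∀ t, (K t : ℂ) = ∑ p, c p * fourier ((p.1 : ℤ) - (p.2 : ℤ)) t) ∧
      ∫ t, K t ∂AddCircle.haarAddCircle = 1 ∧
      ∫ t, K t * (fourier 1 t).re ∂AddCircle.haarAddCircle = Real.cos (π / (n + 1)) := by
  set θ : ℝ := π / (n + 1) with hθ
  have hn0 : (0 : ℝ) < n := by exact_mod_cast hn
  have hθn : (n + 1) * θ = π := by rw [hθ]; field_simp
  set s : ℕ → ℝ := fun k => Real.sin ((k + 1) * θ) with hs
  set A : ℝ := ∑ k ∈ Finset.range n, s k ^ 2 with hA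
  have hsin : Real.sin ((n + 1) * θ) = 0 := by rw [hθn, Real.sin_pi]
  have hsn : s n = 0 := hsin
  have hApos : 0 < A := by
    refine Finset.sum_pos' (fun k _ => sq_nonneg _) ⟨0, Finset.mem_range.2 hn, ?_⟩
    have hθ0 : 0 < θ := by positivity
    have : 0 < s 0 := by
      simp only [hs, Nat.cast_zero, zero_add, one_mul]
      refine Real.sin_pos_of_pos_of_lt_pi hθ0 ?_
      rw [← hθn]
      nlinarith
    positivity
  have hshift : ∑ k ∈ Finset.range n, s k * s (k + 1) = Real.cos θ * A := by
    rw [hA, ← sum_sin_mul_sin_succ n hsin]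
    refine Finset.sum_congr rfl fun k _ => ?_
    simp only [hs]
    push_cast
    ring_nf
  set P : AddCircle (2 * π) → ℂ := fun t => ∑ k : Fin n, (s k : ℂ) * fourier (k : ℤ) t with hP
  set c : Fin n × Fin n → ℂ := fun p => (s p.1 * s p.2 / A : ℝ) with hc
  have hPc : Continuous P := by
    refine continuous_finsetSum _ fun k _ => continuous_const.mul (map_continuous (fourier _))
  set K : AddCircle (2 * π) → ℝ := fun t => ‖P t‖ ^ 2 / A with hK
  have hKc : Continuous K := (hPc.norm.pow 2).div_const _
  have hexp : ∀ t, (K t : ℂ) = ∑ p, c p * fourier ((p.1 : ℤ) - (p.2 : ℤ)) t := by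
    intro t
    have h1 : ((‖P t‖ ^ 2 : ℝ) : ℂ) = P t * (starRingEnd ℂ) (P t) := by
      rw [Complex.mul_conj, Complex.normSq_eq_norm_sq]
    simp only [hK]
    rw [Complex.ofReal_div, h1]
    simp only [hP]
    rw [map_sum, Finset.sum_mul_sum, Fintype.sum_prod_type, Finset.sum_div]
    refine Finset.sum_congr rfl fun k _ => ?_
    rw [Finset.sum_div]
    refine Finset.sum_congr rfl fun l _ => ?_
    rw [map_mul, Complex.conj_ofReal, sub_eq_add_neg, fourier_add, fourier_neg]
    simp only [hc]
    push_cast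
    ring
  have hmoment : ∀ d : ℤ, ∫ t, (K t : ℂ) * fourier d t ∂AddCircle.haarAddCircle
      = ∑ p : Fin n × Fin n, if (p.1 : ℤ) - (p.2 : ℤ) + d = 0 then c p else 0 := by
    intro d
    simp_rw [hexp, Finset.sum_mul, mul_assoc, ← fourier_add]
    rw [integral_finsetSum]
    · refine Finset.sum_congr rfl fun p _ => ?_
      rw [integral_const_mul, integral_fourier_haarAddCircle]
      simp
    · exact fun p _ => integrable_haarAddCircle
        (continuous_const.mul (map_continuous (fourier _)))
  have hint1 : ∫ t, K t ∂AddCircle.haarAddCircle = 1 := by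
    have h := hmoment 0
    simp only [fourier_zero, mul_one] at h
    rw [integral_complex_ofReal, Fintype.sum_prod_type] at h
    have h2 : ∀ k : Fin n, (∑ l : Fin n, if (k : ℤ) - (l : ℤ) + 0 = 0 then c (k, l) else 0)
        = ((s k ^ 2 / A : ℝ) : ℂ) := by
      intro k
      rw [Finset.sum_eq_single k]
      · simp [hc, sq]
      · intro l _ hl
        rw [if_neg]
        contrapose! hl
        ext
        omega
      · simp
    simp_rw [h2] at h
    rw [← Complex.ofReal_sum, Complex.ofReal_inj, ← Finset.sum_div,
      Fin.sum_univ_eq_sum_range (fun k => s k ^ 2) n] at h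
    rw [h, ← hA, div_self hApos.ne']
  have hintcos : ∫ t, K t * (fourier 1 t).re ∂AddCircle.haarAddCircle = Real.cos θ := by
    have h := hmoment 1
    rw [Fintype.sum_prod_type] at h
    have h2 : ∀ k : Fin n, (∑ l : Fin n, if (k : ℤ) - (l : ℤ) + 1 = 0 then c (k, l) else 0)
        = ((s k * s (k + 1) / A : ℝ) : ℂ) := by
      intro k
      by_cases hk : (k : ℕ) + 1 < n
      · rw [Finset.sum_eq_single ⟨k + 1, hk⟩]
        · simp [hc]
        · intro l _ hl
          rw [if_neg]
          contrapose! hl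
          ext
          simp only
          omega
        · simp
      · have hk' : (k : ℕ) + 1 = n := by omega
        rw [hk', hsn, Finset.sum_eq_zero]
        · simp
        · intro l _
          rw [if_neg]
          omega
    simp_rw [h2] at h
    rw [← Complex.ofReal_sum, ← Finset.sum_div,
      Fin.sum_univ_eq_sum_range (fun k => s k * s (k + 1)) n, hshift,
      mul_div_assoc, div_self hApos.ne', mul_one] at h
    have h3 := congrArg Complex.re h
    rw [Complex.ofReal_re] at h3
    rw [← h3, ← Complex.reCLM_apply, ← ContinuousLinearMap.integral_comp_comm]
    · simp
    · exact integrable_haarAddCircle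
        ((Complex.continuous_ofReal.comp hKc).mul (map_continuous (fourier _)))
  exact ⟨K, c, hKc, fun t => div_nonneg (sq_nonneg _) hApos.le, hexp, hint1, hintcos⟩

/-- The Fejér–Korovkin kernel is concentrated at scale `1 / n`. -/
theorem integral_norm_mul_le_of_re_fourier_one (n : ℕ) (hn : 0 < n) {K : AddCircle (2 * π) → ℝ}
    (hKc : Continuous K) (hK0 : ∀ t, 0 ≤ K t) (hint1 : ∫ t, K t ∂AddCircle.haarAddCircle = 1)
    (hintcos : ∫ t, K t * (fourier 1 t).re ∂AddCircle.haarAddCircle = Real.cos (π / (n + 1))) :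
    ∫ t, ‖t‖ * K t ∂AddCircle.haarAddCircle ≤ (1 + π ^ 4 / 4) / 2 / n := by
  have hn0 : (0 : ℝ) < n := by exact_mod_cast hn
  set θ : ℝ := π / (n + 1) with hθ
  have hre : Continuous fun t : AddCircle (2 * π) => (fourier 1 t).re :=
    Complex.continuous_re.comp (map_continuous (fourier 1))
  have hpt : ∀ t : AddCircle (2 * π), ‖t‖ * K t ≤
      (1 / (2 * n) + n * π ^ 2 / 4) * K t - n * π ^ 2 / 4 * (K t * (fourier 1 t).re) := by
    intro t
    have h1 := norm_sq_le_one_sub_re_fourier t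
    have h2 : ‖t‖ ≤ 1 / (2 * n) + n / 2 * ‖t‖ ^ 2 := by
      have : 1 / (2 * n) + n / 2 * ‖t‖ ^ 2 - ‖t‖ = (n * ‖t‖ - 1) ^ 2 / (2 * n) := by
        field_simp
        ring
      have : 0 ≤ (n * ‖t‖ - 1) ^ 2 / (2 * n) := by positivity
      linarith
    have h3 : ‖t‖ ≤ 1 / (2 * n) + n / 2 * (π ^ 2 / 2 * (1 - (fourier 1 t).re)) :=
      h2.trans (by gcongr)
    calc ‖t‖ * K t ≤ (1 / (2 * n) + n / 2 * (π ^ 2 / 2 * (1 - (fourier 1 t).re))) * K t := by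
          exact mul_le_mul_of_nonneg_right h3 (hK0 t)
      _ = _ := by ring
  have hI1 : Integrable (fun t => (1 / (2 * n) + n * π ^ 2 / 4) * K t)
      AddCircle.haarAddCircle := integrable_haarAddCircle (continuous_const.mul hKc)
  have hI2 : Integrable (fun t => n * π ^ 2 / 4 * (K t * (fourier 1 t).re))
      AddCircle.haarAddCircle :=
    integrable_haarAddCircle (continuous_const.mul (hKc.mul hre))
  have hI0 : Integrable (fun t => ‖t‖ * K t) AddCircle.haarAddCircle :=
    integrable_haarAddCircle (by fun_prop)
  refine (integral_mono hI0 (hI1.sub hI2) hpt).trans ?_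
  have hsplit : ∫ t, ((1 / (2 * n) + n * π ^ 2 / 4) * K t - n * π ^ 2 / 4 *
      (K t * (fourier 1 t).re)) ∂AddCircle.haarAddCircle
      = (1 / (2 * n) + n * π ^ 2 / 4) * 1 - n * π ^ 2 / 4 * Real.cos θ := by
    rw [integral_sub hI1 hI2, integral_const_mul, integral_const_mul, hint1, hintcos]
  refine hsplit.le.trans ?_
  have hcos := Real.one_sub_sq_div_two_le_cos (x := θ)
  have hθle : θ ^ 2 ≤ π ^ 2 / n ^ 2 := by
    rw [hθ, div_pow]
    gcongr
    linarith
  have h4 : n * π ^ 2 / 4 * (1 - Real.cos θ) ≤ n * π ^ 2 / 4 * (π ^ 2 / n ^ 2 / 2) := by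
    gcongr
    linarith
  have h5 : n * π ^ 2 / 4 * (π ^ 2 / n ^ 2 / 2) = π ^ 4 / 4 / 2 / n := by
    field_simp
  have h6 : (1 + π ^ 4 / 4) / 2 / n = 1 / (2 * n) + π ^ 4 / 4 / 2 / n := by
    field_simp
  linarith

theorem projT_add {q : ℕ} (x v : Fin q → ℝ) : projT (x + v) = projT x + projT v := by
  ext j
  simp [projT]

theorem exists_projT_eq {q : ℕ} (z : Torus q) :
    ∃ v : Fin q → ℝ, projT v = z ∧ ∀ j, |v j| = ‖z j‖ := by
  choose v hv using fun j => exists_coe_eq_abs_eq_norm (z j)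
  exact ⟨v, funext fun j => (hv j).1, fun j => (hv j).2⟩

/-- The supremum norm of the `j`-th partial derivative. -/
noncomputable def partialNorm {q : ℕ} (f : C(Torus q, ℂ)) (j : Fin q) : ℝ :=
  ⨆ x : Fin q → ℝ, ‖fderiv ℝ (liftT f) x (Pi.single j 1)‖

theorem Wnorm_eq_sum_partialNorm {q : ℕ} (f : C(Torus q, ℂ)) :
    Wnorm f = ∑ j, partialNorm f j := rfl

theorem partialNorm_nonneg {q : ℕ} (f : C(Torus q, ℂ)) (j : Fin q) : 0 ≤ partialNorm f j :=
  Real.iSup_nonneg fun _ => norm_nonneg _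

theorem Wnorm_nonneg {q : ℕ} (f : C(Torus q, ℂ)) : 0 ≤ Wnorm f :=
  Finset.sum_nonneg fun j _ => partialNorm_nonneg f j

theorem fderiv_liftT_eq_of_projT_eq {q : ℕ} (f : C(Torus q, ℂ)) {x y : Fin q → ℝ}
    (hxy : projT x = projT y) : fderiv ℝ (liftT f) x = fderiv ℝ (liftT f) y := by
  have hper : (fun w => liftT f (w + (x - y))) = liftT f := by
    funext w
    have h0 : projT (x - y) = (0 : Torus q) := by
      have := projT_add (x - y) y
      rw [sub_add_cancel, hxy] at this
      exact left_eq_add.1 (this.trans (add_comm _ _))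
    rw [liftT, projT_add, h0, add_zero]
    rfl
  have h := fderiv_comp_add_right (𝕜 := ℝ) (f := liftT f) (x := y) (x - y)
  rw [hper, add_sub_cancel] at h
  exact h.symm

theorem MemW.bddAbove_norm_fderiv {q : ℕ} {f : C(Torus q, ℂ)} (hf : MemW f) (j : Fin q) :
    BddAbove (Set.range fun x : Fin q → ℝ => ‖fderiv ℝ (liftT f) x (Pi.single j 1)‖) := by
  have hcont : Continuous fun x : Fin q → ℝ => ‖fderiv ℝ (liftT f) x (Pi.single j 1)‖ :=
    ((hf.continuous_fderiv one_ne_zero).clm_apply continuous_const).norm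
  obtain ⟨C, hC⟩ := (isCompact_closedBall (0 : Fin q → ℝ) π).bddAbove_image hcont.continuousOn
  refine ⟨C, ?_⟩
  rintro _ ⟨x, rfl⟩
  obtain ⟨v, hv, hvn⟩ := exists_projT_eq (projT x)
  refine hC ⟨v, ?_, by simp only [fderiv_liftT_eq_of_projT_eq f hv]⟩
  rw [mem_closedBall_zero_iff, pi_norm_le_iff_of_nonneg Real.pi_pos.le]
  intro i
  rw [Real.norm_eq_abs, hvn]
  refine (AddCircle.norm_le_half_period _ (by positivity)).trans ?_
  rw [abs_of_pos (by positivity)]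
  linarith

theorem MemW.norm_add_sub_le {q : ℕ} {f : C(Torus q, ℂ)} (hf : MemW f) (z w : Torus q) :
    ‖f (z + w) - f z‖ ≤ ∑ j, ‖w j‖ * partialNorm f j := by
  obtain ⟨x, rfl, -⟩ := exists_projT_eq z
  obtain ⟨v, rfl, hv⟩ := exists_projT_eq w
  rw [← projT_add]
  have hderiv : ∀ t ∈ Set.Icc (0 : ℝ) 1, HasDerivWithinAt (fun t : ℝ => liftT f (x + t • v))
      (fderiv ℝ (liftT f) (x + t • v) v) (Set.Icc 0 1) t := by
    intro t _
    have h1 : HasFDerivAt (liftT f) (fderiv ℝ (liftT f) (x + t • v)) (x + t • v) :=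
      (hf.differentiable one_ne_zero _).hasFDerivAt
    have h2 : HasDerivAt (fun t : ℝ => x + t • v) v t := by
      simpa using ((hasDerivAt_id t).smul_const v).const_add x
    exact (h1.comp_hasDerivAt t h2).hasDerivWithinAt
  have hbound : ∀ t ∈ Set.Ico (0 : ℝ) 1, ‖fderiv ℝ (liftT f) (x + t • v) v‖
      ≤ ∑ j, ‖projT v j‖ * partialNorm f j := by
    intro t _
    have hvsum : v = ∑ j, v j • (Pi.single j 1 : Fin q → ℝ) := by
      simpa using (Finset.univ_sum_single v).symm.trans
        (Finset.sum_congr rfl fun j _ => by rw [← Pi.single_smul]; simp)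
    nth_rewrite 2 [hvsum]
    rw [map_sum]
    refine (norm_sum_le _ _).trans (Finset.sum_le_sum fun j _ => ?_)
    rw [map_smul, norm_smul, Real.norm_eq_abs, hv]
    exact mul_le_mul_of_nonneg_left
      (le_ciSup (hf.bddAbove_norm_fderiv j) (x + t • v)) (norm_nonneg _)
  simpa [liftT] using norm_image_sub_le_of_norm_deriv_le_segment_01' hderiv hbound

theorem MemW.norm_sub_le {q : ℕ} {f : C(Torus q, ℂ)} (hf : MemW f) (z w : Torus q) :
    ‖f z - f w‖ ≤ dist z w * Wnorm f := by
  have h := hf.norm_add_sub_le w (z - w)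
  rw [add_sub_cancel] at h
  refine h.trans ?_
  rw [Wnorm_eq_sum_partialNorm, Finset.mul_sum, dist_eq_norm]
  exact Finset.sum_le_sum fun j _ =>
    mul_le_mul_of_nonneg_right (norm_le_pi_norm (z - w) j) (partialNorm_nonneg f j)

theorem partialNorm_le_of_forall_norm_sub_le {q : ℕ} (f : C(Torus q, ℂ)) (j : Fin q) {L : ℝ}
    (hL : 0 ≤ L) (h : ∀ (z : Torus q) (t : AddCircle (2 * π)),
      ‖f (z + Pi.single j t) - f z‖ ≤ ‖t‖ * L) : partialNorm f j ≤ L := by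
  refine Real.iSup_le (fun x => ?_) hL
  by_cases hd : DifferentiableAt ℝ (liftT f) x
  · have h2 : HasDerivAt (fun t : ℝ => x + t • (Pi.single j 1 : Fin q → ℝ)) (Pi.single j 1) 0 := by
      simpa using ((hasDerivAt_id (0 : ℝ)).smul_const (Pi.single j 1 : Fin q → ℝ)).const_add x
    have h3 : HasDerivAt (fun t : ℝ => liftT f (x + t • (Pi.single j 1 : Fin q → ℝ)))
        (fderiv ℝ (liftT f) x (Pi.single j 1)) 0 := by
      have h1 : HasFDerivAt (liftT f) (fderiv ℝ (liftT f) x)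
          (x + (0 : ℝ) • (Pi.single j 1 : Fin q → ℝ)) := by
        simpa using hd.hasFDerivAt
      exact h1.comp_hasDerivAt 0 h2
    refine h3.le_of_lip' hL (Filter.Eventually.of_forall fun t => ?_)
    have hproj : projT (t • (Pi.single j 1 : Fin q → ℝ))
        = (Pi.single j (t : AddCircle (2 * π)) : Torus q) := by
      funext i
      rcases eq_or_ne i j with rfl | hij
      · simp [projT]
      · simp [projT, hij]
    have h4 := h (projT x) t
    rw [← hproj, ← projT_add] at h4
    have h5 : ‖(t : AddCircle (2 * π))‖ ≤ |t| :=
      QuotientAddGroup.norm_mk_le_norm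
    simp only [zero_smul, add_zero, sub_zero, Real.norm_eq_abs]
    refine h4.trans ?_
    rw [mul_comm L]
    gcongr
  · rw [fderiv_zero_of_not_differentiableAt hd]
    simpa using hL

theorem memW_eK {q : ℕ} (k : Fin q → ℤ) : MemW (eK k) := by
  have h : liftT (eK k) = fun x : Fin q → ℝ =>
      ∏ j, Complex.exp (2 * π * Complex.I * (k j) * (x j : ℝ) / (2 * π : ℝ)) := by
    funext x
    simp [liftT, eK, projT]
  rw [MemW, h]
  refine contDiff_prod fun j _ => ContDiff.cexp (ContDiff.div_const (contDiff_const.mul ?_) _)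
  exact Complex.ofRealCLM.contDiff.comp (contDiff_apply ℝ ℝ j)

theorem memW_of_mem_trigSpan {q : ℕ} {N : ℝ} {T : C(Torus q, ℂ)} (hT : T ∈ trigSpan q N) :
    MemW T := by
  induction hT using Submodule.span_induction with
  | mem T hT =>
    obtain ⟨k, -, rfl⟩ := hT
    exact memW_eK k
  | zero => exact contDiff_const (c := (0 : ℂ))
  | add T U _ _ hT hU => exact ContDiff.add hT hU
  | smul a T _ hT => exact ContDiff.const_smul a hT

theorem l2_le_sum_abs {q : ℕ} (k : Fin q → ℤ) : l2 k ≤ ∑ j, |(k j : ℝ)| := by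
  refine Real.sqrt_le_iff.2 ⟨Finset.sum_nonneg fun _ _ => abs_nonneg _, ?_⟩
  simpa using Finset.sum_sq_le_sq_sum_of_nonneg (s := Finset.univ)
    (f := fun j => |(k j : ℝ)|) fun _ _ => abs_nonneg _

theorem eK_sub {q : ℕ} (k : Fin q → ℤ) (x y : Torus q) :
    eK k (x - y) = eK k x * eK k (-y) := by
  simp only [eK, ContinuousMap.coe_mk, ← Finset.prod_mul_distrib, Pi.sub_apply, Pi.neg_apply]
  refine Finset.prod_congr rfl fun j _ => ?_
  simp only [fourier_apply]
  rw [sub_eq_add_neg, zsmul_add, AddCircle.toCircle_add, Circle.coe_mul]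

theorem integrable_pi_haarAddCircle {q : ℕ} {E : Type*} [NormedAddCommGroup E]
    {g : Torus q → E} (hg : Continuous g) :
    Integrable g (Measure.pi fun _ => AddCircle.haarAddCircle) :=
  hg.integrable_of_hasCompactSupport (HasCompactSupport.of_compactSpace g)

/-- Convolution with a tensor product of nonnegative univariate trigonometric polynomials is
a trigonometric polynomial. -/
theorem exists_trigSpan_eq_convolution {q n : ℕ} {N : ℝ} (hN : 0 < N) (hn : q * (n - 1 : ℝ) < N)
    {K : AddCircle (2 * π) → ℝ} {c : Fin n × Fin n → ℂ}
    (hKc : ∀ t, (K t : ℂ) = ∑ p, c p * fourier ((p.1 : ℤ) - (p.2 : ℤ)) t) (f : C(Torus q, ℂ)) :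
    ∃ T ∈ trigSpan q N, ∀ x, T x =
      ∫ s, f (x - s) * ((∏ j, K (s j) : ℝ) : ℂ) ∂Measure.pi fun _ => AddCircle.haarAddCircle := by
  set d : (Fin q → Fin n × Fin n) → Fin q → ℤ := fun p j => ((p j).1 : ℤ) - ((p j).2 : ℤ) with hd
  have hprod : ∀ s : Torus q, ((∏ j, K (s j) : ℝ) : ℂ)
      = ∑ p : Fin q → Fin n × Fin n, (∏ j, c (p j)) * eK (d p) s := by
    intro s
    rw [Complex.ofReal_prod]
    simp_rw [hKc]
    rw [Finset.prod_univ_sum, Fintype.piFinset_univ]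
    refine Finset.sum_congr rfl fun p _ => ?_
    rw [Finset.prod_mul_distrib]
    rfl
  refine ⟨∑ p : Fin q → Fin n × Fin n, ((∏ j, c (p j)) * ∫ s, f s * eK (d p) (-s)
    ∂Measure.pi fun _ => AddCircle.haarAddCircle) • eK (d p), ?_, fun x => ?_⟩
  · refine Submodule.sum_mem _ fun p _ => Submodule.smul_mem _ _ (Submodule.subset_span
      ⟨d p, ?_, rfl⟩)
    rcases Nat.eq_zero_or_pos q with rfl | hq
    · simpa [l2] using hN
    refine (l2_le_sum_abs _).trans_lt (lt_of_le_of_lt ?_ hn)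
    calc ∑ j, |(d p j : ℝ)| ≤ ∑ _j : Fin q, (n - 1 : ℝ) := by
          refine Finset.sum_le_sum fun j _ => ?_
          have h : |d p j| ≤ (n : ℤ) - 1 := by
            have h1 := (p j).1.isLt
            have h2 := (p j).2.isLt
            simp only [hd, abs_le]
            omega
          exact_mod_cast h
      _ = q * (n - 1 : ℝ) := by simp [mul_sub]
  · have : (AddCircle.haarAddCircle (T := 2 * π)).IsNegInvariant :=
      Measure.IsAddHaarMeasure.isNegInvariant_of_regular _
    have : (Measure.pi fun _ : Fin q => AddCircle.haarAddCircle (T := 2 * π)).IsNegInvariant :=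
      Measure.pi.isNegInvariant _
    have hsub := integral_sub_left_eq_self
      (fun s => f s * ((∏ j, K ((x - s) j) : ℝ) : ℂ))
      (Measure.pi fun _ : Fin q => (AddCircle.haarAddCircle (T := 2 * π))) x
    simp only [sub_sub_cancel] at hsub
    rw [hsub]
    simp_rw [hprod, Finset.mul_sum]
    rw [integral_finsetSum]
    · rw [ContinuousMap.coe_sum, Finset.sum_apply]
      refine Finset.sum_congr rfl fun p _ => ?_
      rw [ContinuousMap.coe_smul, Pi.smul_apply, smul_eq_mul, mul_assoc, mul_comm (∫ _, _ ∂_),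
        ← integral_const_mul, ← integral_const_mul]
      refine integral_congr_ae (Filter.Eventually.of_forall fun s => ?_)
      simp only [eK_sub]
      ring
    · intro p _
      refine integrable_pi_haarAddCircle (f.continuous.mul (continuous_const.mul ?_))
      exact (eK (d p)).continuous.comp (continuous_const.sub continuous_id)

/-- The constant in the Jackson inequality for the Fejér–Korovkin kernel. -/
noncomputable def jacksonConst : ℝ := (1 + π ^ 4 / 4) / 2

theorem jacksonConst_pos : 0 < jacksonConst := by
  unfold jacksonConst
  positivity

/-- Jackson's inequality, with control of the partial derivatives of the approximant. -/
theorem MemW.exists_mem_trigSpan_norm_sub_le {q : ℕ} {N : ℝ} (hN : 0 < N) {f : C(Torus q, ℂ)}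
    (hf : MemW f) : ∃ T ∈ trigSpan q N,
      (∀ x, ‖f x - T x‖ ≤ (q + 1) * jacksonConst / N * Wnorm f) ∧ Wnorm T ≤ Wnorm f := by
  set n : ℕ := ⌈N / (q + 1)⌉₊ with hndef
  have hq : (0 : ℝ) < q + 1 := by positivity
  have hn : 0 < n := Nat.ceil_pos.2 (by positivity)
  have hnN : N / (q + 1) ≤ n := Nat.le_ceil _
  have hn1 : (1 : ℝ) ≤ n := by exact_mod_cast hn
  have hnlt : q * (n - 1 : ℝ) < N := by
    have h1 : (n : ℝ) < N / (q + 1) + 1 := Nat.ceil_lt_add_one (by positivity)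
    have h2 : (n - 1 : ℝ) < N / (q + 1) := by linarith
    rw [lt_div_iff₀ hq] at h2
    nlinarith
  obtain ⟨K, c, hKcont, hK0, hKc, hK1, hKcos⟩ := exists_fejerKorovkin_kernel n hn
  have hKnorm := integral_norm_mul_le_of_re_fourier_one n hn hKcont hK0 hK1 hKcos
  obtain ⟨T, hT, hTx⟩ := exists_trigSpan_eq_convolution hN hnlt hKc f
  set μ : Measure (Torus q) := Measure.pi fun _ => AddCircle.haarAddCircle with hμ
  set w : Torus q → ℝ := fun s => ∏ j, K (s j) with hw
  have hw0 : ∀ s, 0 ≤ w s := fun s => Finset.prod_nonneg fun j _ => hK0 _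
  have hwc : Continuous w :=
    continuous_finsetProd _ fun j _ => hKcont.comp (continuous_apply j)
  have hwcC : Continuous fun s => (w s : ℂ) := Complex.continuous_ofReal.comp hwc
  have hw1 : ∫ s, w s ∂μ = 1 := by
    rw [hμ, integral_fintype_prod_eq_prod (fun _ => K)]
    simp [hK1]
  have hwj : ∀ j, ∫ s, ‖s j‖ * w s ∂μ ≤ jacksonConst / n := by
    intro j
    have h1 : ∀ s : Torus q, ‖s j‖ * w s = ∏ i, (if i = j then ‖s i‖ * K (s i) else K (s i)) := by
      intro s
      rw [← Finset.mul_prod_erase _ _ (Finset.mem_univ j), if_pos rfl, hw]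
      simp only
      rw [← Finset.mul_prod_erase _ _ (Finset.mem_univ j), mul_assoc]
      congr 2
      exact Finset.prod_congr rfl fun i hi => (if_neg (Finset.ne_of_mem_erase hi)).symm
    simp_rw [h1]
    rw [hμ, integral_fintype_prod_eq_prod
      (fun i (t : AddCircle (2 * π)) => if i = j then ‖t‖ * K t else K t),
      ← Finset.mul_prod_erase _ _ (Finset.mem_univ j), Finset.prod_eq_one]
    · simpa [jacksonConst] using hKnorm
    · intro i hi
      simpa [Finset.ne_of_mem_erase hi] using hK1
  have hfc : ∀ x, Continuous fun s => f (x - s) := fun x =>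
    f.continuous.comp (continuous_const.sub continuous_id)
  refine ⟨T, hT, fun x => ?_, ?_⟩
  · have hfx : f x = ∫ s, f x * (w s : ℂ) ∂μ := by
      rw [integral_const_mul, integral_complex_ofReal, hw1, Complex.ofReal_one, mul_one]
    rw [hTx, hfx, ← integral_sub]
    · have hle : ∀ s, ‖f x * (w s : ℂ) - f (x - s) * (w s : ℂ)‖
          ≤ ∑ j, partialNorm f j * (‖s j‖ * w s) := by
        intro s
        rw [← sub_mul, norm_mul, Complex.norm_real, Real.norm_of_nonneg (hw0 s), norm_sub_rev]
        have h := hf.norm_add_sub_le x (-s)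
        rw [← sub_eq_add_neg] at h
        refine (mul_le_mul_of_nonneg_right h (hw0 s)).trans_eq ?_
        rw [Finset.sum_mul]
        refine Finset.sum_congr rfl fun j _ => ?_
        rw [Pi.neg_apply, norm_neg]
        ring
      have hint : ∀ j, Integrable (fun s => partialNorm f j * (‖s j‖ * w s)) μ := fun j =>
        integrable_pi_haarAddCircle
          (continuous_const.mul ((continuous_norm.comp (continuous_apply j)).mul hwc))
      refine (norm_integral_le_of_norm_le (integrable_finsetSum _ fun j _ => hint j)
        (Filter.Eventually.of_forall hle)).trans ?_
      rw [integral_finsetSum _ fun j _ => hint j, Wnorm_eq_sum_partialNorm, Finset.mul_sum]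
      refine Finset.sum_le_sum fun j _ => ?_
      rw [integral_const_mul, mul_comm]
      refine mul_le_mul_of_nonneg_right ((hwj j).trans ?_) (partialNorm_nonneg f j)
      rw [div_le_div_iff₀ (by linarith) hN]
      rw [div_le_iff₀ hq] at hnN
      nlinarith [jacksonConst_pos]
    · exact integrable_pi_haarAddCircle (continuous_const.mul hwcC)
    · exact integrable_pi_haarAddCircle ((hfc x).mul hwcC)
  · rw [Wnorm_eq_sum_partialNorm, Wnorm_eq_sum_partialNorm]
    refine Finset.sum_le_sum fun j _ => partialNorm_le_of_forall_norm_sub_le T j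
      (partialNorm_nonneg f j) fun z t => ?_
    rw [hTx, hTx, ← integral_sub]
    · have hle : ∀ s, ‖f (z + Pi.single j t - s) * (w s : ℂ) - f (z - s) * (w s : ℂ)‖
          ≤ ‖t‖ * partialNorm f j * w s := by
        intro s
        rw [← sub_mul, norm_mul, Complex.norm_real, Real.norm_of_nonneg (hw0 s)]
        refine mul_le_mul_of_nonneg_right ?_ (hw0 s)
        rw [add_sub_right_comm]
        refine (hf.norm_add_sub_le (z - s) (Pi.single j t)).trans_eq ?_
        rw [Finset.sum_eq_single j]
        · simp
        · intro i _ hij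
          simp [hij]
        · simp
      refine (norm_integral_le_of_norm_le ((integrable_pi_haarAddCircle hwc).const_mul _)
        (Filter.Eventually.of_forall hle)).trans_eq ?_
      rw [integral_const_mul, ← hμ, hw1, mul_one]
    · exact integrable_pi_haarAddCircle ((hfc _).mul hwcC)
    · exact integrable_pi_haarAddCircle ((hfc z).mul hwcC)

/-- pointwise generalization error for the regularization scheme: for
`f ∈ W*(𝕋^q)`, `N ≥ B η(C)⁻¹`, and any minimizer `T*(D)` of `R_N` over `H_N^q`, for every
`x ∈ 𝕋^q` with `δ = min_j |x − x_j|` one has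
`|f(x) − T*(D)(x)| ≤ c (1 + Nδ) { ε + (1/N) ‖f‖_{W*} }`. -/
theorem regularization_good_generalization_error (q : ℕ) (h : ℝ → ℝ) (hh : SmoothCutoff h)
    (S : ℕ) (hS : q < S) :
    ∃ B > 0, ∃ c > 0, ∀ (M : ℕ), 0 < M → ∀ (x : Fin M → Torus q) (f : C(Torus q, ℂ)),
      MemW f → ∀ (y : Fin M → ℂ) (ε : ℝ), 0 ≤ ε → (∀ j, ‖y j - f (x j)‖ ≤ ε) →
      0 < minSep x → ∀ N : ℝ, B / minSep x ≤ N →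
      ∀ Tstar : C(Torus q, ℂ), Tstar ∈ trigSpan q N →
      (∀ T ∈ trigSpan q N, regFunc N x y Tstar ≤ regFunc N x y T) →
      ∀ z : Torus q,
        ‖f z - Tstar z‖
          ≤ c * (1 + N * ⨅ j, dist z (x j)) * (ε + (1 / N) * Wnorm f) := by
  have hA : 0 < (q + 1) * jacksonConst := mul_pos (by positivity) jacksonConst_pos
  set A : ℝ := (q + 1) * jacksonConst with hAdef
  refine ⟨1, one_pos, A + 3, by linarith, ?_⟩
  intro M hM x f hf y ε hε hy hsep N hN Tstar hTstar hmin z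
  have hN0 : 0 < N := lt_of_lt_of_le (by positivity) hN
  have : Nonempty (Fin M) := ⟨⟨0, hM⟩⟩
  set W : ℝ := Wnorm f with hW
  have hW0 : 0 ≤ W := Wnorm_nonneg f
  obtain ⟨T, hT, hfT, hTW⟩ := hf.exists_mem_trigSpan_norm_sub_le hN0
  set R : ℝ := regFunc N x y Tstar with hR
  have hRle : R ≤ (A + 1) * (ε + 1 / N * W) := by
    refine (hmin T hT).trans ?_
    have h1 : (⨆ j, ‖y j - T (x j)‖) ≤ ε + A / N * W := by
      refine ciSup_le fun j => ?_
      calc ‖y j - T (x j)‖ ≤ ‖y j - f (x j)‖ + ‖f (x j) - T (x j)‖ :=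
            norm_sub_le_norm_sub_add_norm_sub _ _ _
        _ ≤ ε + A / N * W := add_le_add (hy j) (hfT _)
    have h2 : 1 / N * Wnorm T ≤ 1 / N * W := by gcongr
    have h3 : (A + 1) * (ε + 1 / N * W) = ε + A / N * W + 1 / N * W + A * ε := by ring
    have h4 : 0 ≤ A * ε := by positivity
    unfold regFunc
    linarith
  have hresid : ∀ j, ‖y j - Tstar (x j)‖ ≤ R := by
    intro j
    have h1 := le_ciSup (Set.finite_range fun j => ‖y j - Tstar (x j)‖).bddAbove j
    have h2 : 0 ≤ 1 / N * Wnorm Tstar := mul_nonneg (by positivity) (Wnorm_nonneg _)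
    simp only [hR, regFunc]
    linarith
  have hWstar : Wnorm Tstar ≤ N * R := by
    have h1 : 0 ≤ ⨆ j, ‖y j - Tstar (x j)‖ := Real.iSup_nonneg fun _ => norm_nonneg _
    have h2 : 1 / N * Wnorm Tstar ≤ R := by
      simp only [hR, regFunc]
      linarith
    calc Wnorm Tstar = N * (1 / N * Wnorm Tstar) := by field_simp
      _ ≤ N * R := by gcongr
  obtain ⟨j, hj⟩ := exists_eq_ciInf_of_finite (f := fun j => dist z (x j))
  rw [← hj]
  set δ : ℝ := dist z (x j) with hδ
  have hδ0 : 0 ≤ δ := dist_nonneg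
  have h1 : ‖f z - f (x j)‖ ≤ δ * W := hf.norm_sub_le z (x j)
  have h2 : ‖f (x j) - y j‖ ≤ ε := (norm_sub_rev _ _).trans_le (hy j)
  have h3 : ‖Tstar (x j) - Tstar z‖ ≤ δ * (N * R) := by
    rw [norm_sub_rev]
    exact ((memW_of_mem_trigSpan hTstar).norm_sub_le z (x j)).trans (by gcongr)
  have htri : ‖f z - Tstar z‖ ≤ δ * W + ε + R + δ * (N * R) := by
    have h := norm_add₄_le (a := f z - f (x j)) (b := f (x j) - y j)
      (c := y j - Tstar (x j)) (d := Tstar (x j) - Tstar z)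
    rw [sub_add_sub_cancel, sub_add_sub_cancel, sub_add_sub_cancel] at h
    linarith [hresid j]
  set E : ℝ := ε + 1 / N * W with hE
  have hWE : δ * W + ε ≤ (1 + N * δ) * E := by
    have h4 : (1 + N * δ) * E = δ * W + ε + 1 / N * W + N * δ * ε := by
      rw [hE]
      field_simp
      ring
    have h5 : 0 ≤ 1 / N * W + N * δ * ε := by positivity
    linarith
  have hE0 : 0 ≤ E := by positivity
  calc ‖f z - Tstar z‖ ≤ (δ * W + ε) + (1 + N * δ) * R := by linarith
    _ ≤ (1 + N * δ) * E + (1 + N * δ) * ((A + 1) * E) := by gcongr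
    _ = (A + 2) * (1 + N * δ) * E := by ring
    _ ≤ (A + 3) * (1 + N * δ) * E := by gcongr; norm_num
end

section
/- Let S > q be an integer. For all N ≥ 1 and x ∈ 𝕋^q: (i) |Φ_N(x)| ≤ Φ_N(0) and Φ_N(0) ≥ c N^q; (ii) |Φ_N(x)| ≤ c N^q / max(1, (N|x|)^S); in particular, for x ≠ 0, |Φ_N(x)| ≤ c N^q (N|x|)^{-S}, where the constants c depend only on q, h, S. -/
open MeasureTheory Real

/-- An `n`-th order finite difference is bounded by the `n`-th derivative. -/
lemma norm_fwdDiff_iterate_le {E F : Type*} [NormedAddCommGroup E] [NormedSpace ℝ E]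
    [NormedAddCommGroup F] [NormedSpace ℝ F] (v : E) (n : ℕ) :
    ∀ (M : ℝ) (g : E → F), ContDiff ℝ n g → (∀ y, ‖iteratedFDeriv ℝ n g y‖ ≤ M) →
      ∀ y, ‖(fwdDiff v)^[n] g y‖ ≤ M * ‖v‖ ^ n := by
  induction n with
  | zero =>
    intro M g _ hM y
    simpa using hM y
  | succ n ih =>
    intro M g hg hM y
    have hgn : ContDiff ℝ n g := hg.of_le (by exact_mod_cast n.le_succ)
    have hgv : ContDiff ℝ n (fun z => g (z + v)) := hgn.comp (contDiff_id.add contDiff_const)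
    have hd : fwdDiff v g = (fun z => g (z + v)) - g := rfl
    have key := ih (M * ‖v‖) (fwdDiff v g) (hd ▸ hgv.sub hgn) (fun z => by
      rw [hd, iteratedFDeriv_sub_apply hgv.contDiffAt hgn.contDiffAt,
        iteratedFDeriv_comp_add_right]
      have hmv := Convex.norm_image_sub_le_of_norm_fderiv_le (𝕜 := ℝ)
        (f := iteratedFDeriv ℝ n g) (C := M) (s := Set.univ) (x := z) (y := z + v)
        (fun x _ => hg.differentiable_iteratedFDeriv (by exact_mod_cast n.lt_succ_self) x)
        (fun x _ => by rw [norm_fderiv_iteratedFDeriv]; exact hM x)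
        convex_univ (Set.mem_univ _) (Set.mem_univ _)
      simpa using hmv) y
    rw [Function.iterate_succ_apply]
    calc _ ≤ _ := key
      _ = _ := by ring

/-- Finite differences commute with additive changes of variables. -/
lemma fwdDiff_iterate_comp_addMonoidHom {A B G : Type*} [AddCommMonoid A] [AddCommMonoid B]
    [AddCommGroup G] (φ : A →+ B) (v : A) (n : ℕ) :
    ∀ g : B → G, (fwdDiff v)^[n] (g ∘ φ) = ((fwdDiff (φ v))^[n] g) ∘ φ := by
  induction n with
  | zero => intro g; rfl
  | succ n ih =>
    intro g
    have h1 : fwdDiff v (g ∘ φ) = fwdDiff (φ v) g ∘ φ := by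
      funext a; simp [fwdDiff]
    rw [Function.iterate_succ_apply, Function.iterate_succ_apply, h1, ih]

/-- A smooth cutoff composed with the norm is a smooth function. -/
lemma SmoothCutoff.contDiff_comp_norm {h : ℝ → ℝ} (hh : SmoothCutoff h) {E : Type*}
    [NormedAddCommGroup E] [InnerProductSpace ℝ E] :
    ContDiff ℝ (⊤ : ℕ∞) (fun y : E => h ‖y‖) := by
  rw [contDiff_iff_contDiffAt]
  intro y
  rcases eq_or_ne y 0 with rfl | hy
  · have h1 : (fun y : E => h ‖y‖) =ᶠ[nhds 0] fun _ => 1 := by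
      filter_upwards [Metric.ball_mem_nhds (0 : E) (show (0 : ℝ) < 1 / 2 by norm_num)] with z hz
      apply hh.eq_one
      rw [abs_norm]
      exact (mem_ball_zero_iff.mp hz).le
    exact contDiffAt_const.congr_of_eventuallyEq h1
  · exact hh.smooth.contDiffAt.comp y (contDiffAt_norm ℝ hy)

lemma SmoothCutoff.hasCompactSupport_comp_norm {h : ℝ → ℝ} (hh : SmoothCutoff h) {E : Type*}
    [NormedAddCommGroup E] [ProperSpace E] :
    HasCompactSupport (fun y : E => h ‖y‖) := by
  apply HasCompactSupport.intro (isCompact_closedBall (0 : E) 1)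
  intro y hy
  apply hh.eq_zero
  rw [abs_norm]
  simp only [Metric.mem_closedBall, dist_zero_right, not_le] at hy
  exact hy.le

/-- All finite differences of a radial smooth cutoff are bounded by powers of the step. -/
lemma SmoothCutoff.exists_norm_fwdDiff_le {h : ℝ → ℝ} (hh : SmoothCutoff h) (E : Type*)
    [NormedAddCommGroup E] [InnerProductSpace ℝ E] [ProperSpace E] (n : ℕ) :
    ∃ M : ℝ, ∀ v y : E, ‖(fwdDiff v)^[n] (fun y : E => ((h ‖y‖ : ℝ) : ℂ)) y‖ ≤ M * ‖v‖ ^ n := by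
  have hsm : ContDiff ℝ (⊤ : ℕ∞) (fun y : E => ((h ‖y‖ : ℝ) : ℂ)) :=
    Complex.ofRealCLM.contDiff.comp hh.contDiff_comp_norm
  have hcs : HasCompactSupport (fun y : E => ((h ‖y‖ : ℝ) : ℂ)) :=
    (hh.hasCompactSupport_comp_norm (E := E)).comp_left (g := fun t : ℝ => (t : ℂ)) (by simp)
  have hsn : ContDiff ℝ n (fun y : E => ((h ‖y‖ : ℝ) : ℂ)) :=
    hsm.of_le (by exact_mod_cast le_top)
  obtain ⟨M, hM⟩ := (hcs.iteratedFDeriv (𝕜 := ℝ) n).exists_bound_of_continuous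
    (hsn.continuous_iteratedFDeriv le_rfl)
  exact ⟨M, fun v => norm_fwdDiff_iterate_le v n M _ hsn hM⟩

lemma norm_eK {q : ℕ} (k : Fin q → ℤ) (x : Torus q) : ‖eK k x‖ = 1 := by
  simp only [eK, ContinuousMap.coe_mk, norm_prod]
  exact Finset.prod_eq_one fun j _ => Circle.norm_coe _

lemma eK_zero_right {q : ℕ} (k : Fin q → ℤ) : eK k 0 = 1 := by
  simp [eK]

lemma eK_add {q : ℕ} (k l : Fin q → ℤ) (x : Torus q) : eK (k + l) x = eK k x * eK l x := by
  simp only [eK, ContinuousMap.coe_mk, Pi.add_apply, fourier_add, Finset.prod_mul_distrib]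

lemma eK_single {q : ℕ} (j : Fin q) (x : Torus q) : eK (Pi.single j 1) x = fourier 1 (x j) := by
  simp only [eK, ContinuousMap.coe_mk]
  rw [Finset.prod_eq_single j]
  · simp
  · intro i _ hij
    simp [Pi.single_eq_of_ne hij]
  · simp

/-- The chord `|exp(it) - 1|` dominates the arc `|t|` up to the factor `2/π`. -/
lemma two_div_pi_mul_norm_le (x : AddCircle (2 * π)) :
    2 / π * ‖x‖ ≤ ‖fourier 1 x - 1‖ := by
  have hp : (0 : ℝ) < 2 * π := by positivity
  obtain ⟨t, ht, rfl⟩ : ∃ t ∈ Set.Ico (-π) (-π + 2 * π), (t : AddCircle (2 * π)) = x := by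
    have := AddCircle.coe_image_Ico_eq (2 * π) (-π)
    have hx : x ∈ ((↑) : ℝ → AddCircle (2 * π)) '' Set.Ico (-π) (-π + 2 * π) := by
      rw [this]; trivial
    exact hx
  have habs : |t| ≤ π := abs_le.mpr ⟨ht.1, by linarith [ht.2]⟩
  have hn : ‖(t : AddCircle (2 * π))‖ = |t| := by
    rw [AddCircle.norm_coe_eq_abs_iff _ hp.ne', abs_of_pos hp]
    linarith
  have hf : (fourier 1 (t : AddCircle (2 * π)) : ℂ) = Complex.exp (Complex.I * t) := by
    rw [fourier_coe_apply]
    congr 1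
    have : (π : ℂ) ≠ 0 := by exact_mod_cast pi_ne_zero
    push_cast
    field_simp
  rw [hn, hf, Complex.norm_exp_I_mul_ofReal_sub_one, norm_mul, Real.norm_eq_abs,
    Real.norm_eq_abs, abs_two]
  have := mul_abs_le_abs_sin (x := t / 2) (by rw [abs_div, abs_two]; linarith)
  rw [abs_div, abs_two] at this
  calc 2 / π * |t| = 2 * (2 / π * (|t| / 2)) := by ring
    _ ≤ _ := by gcongr

/-- The cube of frequencies of sup norm at most `r`. -/
noncomputable abbrev freqCube (q : ℕ) (r : ℤ) : Finset (Fin q → ℤ) :=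
  Finset.Icc (fun _ => -r) (fun _ => r)

lemma card_freqCube (q : ℕ) {r : ℤ} (hr : 0 ≤ r) :
    ((freqCube q r).card : ℝ) = (2 * (r : ℝ) + 1) ^ q := by
  rw [Pi.card_Icc]
  simp only [Int.card_Icc, Finset.prod_const, Finset.card_univ, Fintype.card_fin, Nat.cast_pow]
  congr 1
  have h1 : (((r + 1 - -r).toNat : ℤ) : ℝ) = ((r + 1 - -r : ℤ) : ℝ) := by
    rw [Int.toNat_of_nonneg (by omega)]
  push_cast at h1
  rw [h1]; ring

lemma fwdDiff_single_eq_zero {q : ℕ} {a : (Fin q → ℤ) → ℂ} {r : ℤ} (j : Fin q)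
    (ha : ∀ k ∉ freqCube q r, a k = 0) :
    ∀ k ∉ freqCube q (r + 1), fwdDiff (Pi.single j 1) a k = 0 := by
  intro k hk
  have h1 : k ∉ freqCube q r := by
    contrapose! hk
    simp only [Finset.mem_Icc, Pi.le_def] at hk ⊢
    exact ⟨fun i => by linarith [hk.1 i], fun i => by linarith [hk.2 i]⟩
  have h2 : k + Pi.single j 1 ∉ freqCube q r := by
    contrapose! hk
    simp only [Finset.mem_Icc, Pi.le_def, Pi.add_apply] at hk ⊢
    have h01 : ∀ i, 0 ≤ (Pi.single j 1 : Fin q → ℤ) i ∧ (Pi.single j 1 : Fin q → ℤ) i ≤ 1 := by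
      intro i
      rcases eq_or_ne i j with rfl | hij
      · simp
      · simp [Pi.single_eq_of_ne hij]
    exact ⟨fun i => by linarith [hk.1 i, h01 i], fun i => by linarith [hk.2 i, h01 i]⟩
  simp [fwdDiff, ha _ h1, ha _ h2]

/-- Summation by parts for a trigonometric sum, in absolute value. -/
lemma norm_tsum_fwdDiff {q : ℕ} {a : (Fin q → ℤ) → ℂ} {r : ℤ} (j : Fin q) (x : Torus q)
    (ha : ∀ k ∉ freqCube q r, a k = 0) :
    ‖∑' k, fwdDiff (Pi.single j 1) a k * eK k x‖
      = ‖(fourier 1 (x j) : ℂ) - 1‖ * ‖∑' k, a k * eK k x‖ := by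
  set w : ℂ := fourier 1 (x j) with hw
  have hw1 : ‖w‖ = 1 := by rw [hw, ← eK_single, norm_eK]
  have hs : Summable fun k => a k * eK k x :=
    summable_of_ne_finset_zero (s := freqCube q r) fun k hk => by simp [ha k hk]
  have hshift : (fun k => w * (a (k + Pi.single j 1) * eK k x))
      = (fun k => a k * eK k x) ∘ (Equiv.addRight (Pi.single j 1 : Fin q → ℤ)) := by
    funext k
    simp only [Function.comp, Equiv.coe_addRight, eK_add, eK_single, ← hw]
    ring
  have hs1 : Summable fun k => w * (a (k + Pi.single j 1) * eK k x) := by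
    rw [hshift]
    exact (Equiv.summable_iff _).mpr hs
  have ht1 : ∑' k, w * (a (k + Pi.single j 1) * eK k x) = ∑' k, a k * eK k x := by
    rw [hshift]
    exact Equiv.tsum_eq (Equiv.addRight (Pi.single j 1 : Fin q → ℤ)) (fun k => a k * eK k x)
  have hmain : w * ∑' k, fwdDiff (Pi.single j 1) a k * eK k x
      = (1 - w) * ∑' k, a k * eK k x := by
    rw [← tsum_mul_left, sub_mul, one_mul, ← tsum_mul_left]
    conv_rhs => rw [← ht1]
    rw [← hs1.tsum_sub (hs.mul_left w)]
    congr 1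
    funext k
    simp only [fwdDiff]
    ring
  have := congrArg norm hmain
  rwa [norm_mul, norm_mul, hw1, one_mul, norm_sub_rev] at this

/-- Iterated summation by parts. -/
lemma norm_pow_mul_norm_tsum_le {q : ℕ} (j : Fin q) (x : Torus q) (n : ℕ) :
    ∀ (a : (Fin q → ℤ) → ℂ) (r : ℤ) (B : ℝ), 0 ≤ r → (∀ k ∉ freqCube q r, a k = 0) →
      (∀ k, ‖(fwdDiff (Pi.single j 1))^[n] a k‖ ≤ B) →
      ‖(fourier 1 (x j) : ℂ) - 1‖ ^ n * ‖∑' k, a k * eK k x‖ ≤ (2 * (r + n : ℝ) + 1) ^ q * B := by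
  induction n with
  | zero =>
    intro a r B hr ha hB
    rw [tsum_eq_sum (s := freqCube q r) fun k hk => by simp [ha k hk]]
    have := norm_sum_le_of_le (freqCube q r) (f := fun k => a k * eK k x) (n := fun _ => B)
      fun k _ => by simpa [norm_eK] using hB k
    rw [Finset.sum_const, nsmul_eq_mul, card_freqCube q hr] at this
    simpa using this
  | succ n ih =>
    intro a r B hr ha hB
    have := ih (fwdDiff (Pi.single j 1) a) (r + 1) B (by omega) (fwdDiff_single_eq_zero j ha) hB
    rw [norm_tsum_fwdDiff j x ha] at this
    push_cast at this ⊢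
    calc _ = _ := by ring
      _ ≤ _ := this
      _ = _ := by ring

/-- Scaling by `N⁻¹` from the frequency lattice to Euclidean space. -/
noncomputable def scaleHom (q : ℕ) (N : ℝ) : (Fin q → ℤ) →+ EuclideanSpace ℝ (Fin q) where
  toFun k := WithLp.toLp 2 fun j => (k j : ℝ) / N
  map_zero' := by ext; simp
  map_add' k l := by ext; simp [add_div]

lemma norm_scaleHom {q : ℕ} {N : ℝ} (hN : 0 < N) (k : Fin q → ℤ) :
    ‖scaleHom q N k‖ = l2 k / N := by
  rw [EuclideanSpace.norm_eq, l2]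
  simp only [scaleHom, AddMonoidHom.coe_mk, ZeroHom.coe_mk, Real.norm_eq_abs, sq_abs, div_pow]
  rw [← Finset.sum_div, Real.sqrt_div (Finset.sum_nonneg fun _ _ => sq_nonneg _),
    Real.sqrt_sq hN.le]

lemma l2_single {q : ℕ} (j : Fin q) : l2 (Pi.single j 1 : Fin q → ℤ) = 1 := by
  rw [l2, Finset.sum_eq_single j]
  · simp
  · intro i _ hij
    simp [Pi.single_eq_of_ne hij]
  · simp

lemma abs_le_l2 {q : ℕ} (k : Fin q → ℤ) (j : Fin q) : |(k j : ℝ)| ≤ l2 k := by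
  rw [l2, ← Real.sqrt_sq_eq_abs]
  exact Real.sqrt_le_sqrt (Finset.single_le_sum (f := fun j => ((k j : ℝ)) ^ 2)
    (fun _ _ => sq_nonneg _) (Finset.mem_univ j))

lemma SmoothCutoff.eq_zero_of_notMem_box {h : ℝ → ℝ} (hh : SmoothCutoff h) {q : ℕ} {N : ℝ}
    (hN : 0 < N) {k : Fin q → ℤ} (hk : k ∉ box q N) : h (l2 k / N) = 0 := by
  apply hh.eq_zero
  have hl : 0 ≤ l2 k := Real.sqrt_nonneg _
  rw [abs_of_nonneg (by positivity)]
  contrapose! hk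
  rw [div_lt_one hN] at hk
  have hb : ∀ j, |k j| ≤ ⌈N⌉ := fun j => by
    have := ((abs_le_l2 k j).trans hk.le).trans (Int.le_ceil N)
    exact_mod_cast this
  simp only [box, Finset.mem_Icc, Pi.le_def]
  exact ⟨fun j => (abs_le.mp (hb j)).1, fun j => (abs_le.mp (hb j)).2⟩

lemma Phi_apply (q : ℕ) (h : ℝ → ℝ) (N : ℝ) (x : Torus q) :
    Phi q h N x = ∑ k ∈ box q N, ((h (l2 k / N) : ℝ) : ℂ) * eK k x := by
  simp [Phi, ContinuousMap.sum_apply]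

lemma Phi_zero_re (q : ℕ) (h : ℝ → ℝ) (N : ℝ) :
    (Phi q h N 0).re = ∑ k ∈ box q N, h (l2 k / N) := by
  simp [Phi_apply, eK_zero_right]

lemma norm_Phi_le {q : ℕ} {h : ℝ → ℝ} (hh : SmoothCutoff h) (N : ℝ) (x : Torus q) :
    ‖Phi q h N x‖ ≤ (Phi q h N 0).re := by
  rw [Phi_zero_re, Phi_apply]
  refine norm_sum_le_of_le _ fun k _ => ?_
  rw [norm_mul, norm_eK, mul_one, Complex.norm_real, Real.norm_of_nonneg (hh.nonneg _)]

lemma Phi_zero_le {q : ℕ} {h : ℝ → ℝ} (hh : SmoothCutoff h) {N : ℝ} (hN : 1 ≤ N) :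
    (Phi q h N 0).re ≤ 5 ^ q * N ^ q := by
  rw [Phi_zero_re]
  have hc : (0 : ℤ) ≤ ⌈N⌉ := Int.ceil_nonneg (by linarith)
  calc ∑ k ∈ box q N, h (l2 k / N) ≤ ∑ k ∈ box q N, (1 : ℝ) :=
        Finset.sum_le_sum fun k _ => hh.le_one _
    _ = (2 * (⌈N⌉ : ℝ) + 1) ^ q := by
        rw [← card_freqCube q hc]; simp [box]
    _ ≤ (5 * N) ^ q := by
        have := (Int.ceil_lt_add_one N).le
        have hc' : (0 : ℝ) ≤ ⌈N⌉ := by exact_mod_cast hc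
        gcongr
        linarith
    _ = _ := mul_pow _ _ _

lemma le_Phi_zero {q : ℕ} {h : ℝ → ℝ} (hh : SmoothCutoff h) {N : ℝ} (hN : 1 ≤ N) :
    (1 / (2 * (q + 1 : ℝ))) ^ q * N ^ q ≤ (Phi q h N 0).re := by
  have hN0 : 0 < N := by linarith
  have hq0 : (0 : ℝ) < 2 * (q + 1 : ℝ) := by positivity
  set m : ℤ := ⌊N / (2 * (q + 1 : ℝ))⌋ with hm
  have hm0 : 0 ≤ m := Int.floor_nonneg.mpr (by positivity)
  have hmle : (m : ℝ) ≤ N / (2 * (q + 1 : ℝ)) := Int.floor_le _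
  have hmlt : N / (2 * (q + 1 : ℝ)) < m + 1 := Int.lt_floor_add_one _
  have hmN : m ≤ ⌈N⌉ := by
    have h1 : N / (2 * (q + 1 : ℝ)) ≤ N :=
      div_le_self hN0.le (by linarith [(Nat.cast_nonneg q : (0 : ℝ) ≤ q)])
    exact_mod_cast (hmle.trans h1).trans (Int.le_ceil N)
  have hsub : freqCube q m ⊆ box q N :=
    Finset.Icc_subset_Icc (fun _ => neg_le_neg hmN) (fun _ => hmN)
  have hone : ∀ k ∈ freqCube q m, h (l2 k / N) = 1 := by
    intro k hk
    apply hh.eq_one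
    have hl : 0 ≤ l2 k := Real.sqrt_nonneg _
    rw [abs_of_nonneg (by positivity), div_le_iff₀ hN0, l2]
    apply Real.sqrt_le_iff.mpr
    refine ⟨by positivity, ?_⟩
    simp only [Finset.mem_Icc, Pi.le_def] at hk
    have hkj : ∀ j, ((k j : ℝ)) ^ 2 ≤ (N / (2 * (q + 1 : ℝ))) ^ 2 := fun j => by
      apply sq_le_sq'
      · have : (-m : ℝ) ≤ k j := by exact_mod_cast hk.1 j
        linarith
      · have : (k j : ℝ) ≤ m := by exact_mod_cast hk.2 j
        linarith
    calc ∑ j, ((k j : ℝ)) ^ 2 ≤ ∑ _j : Fin q, (N / (2 * (q + 1 : ℝ))) ^ 2 :=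
          Finset.sum_le_sum fun j _ => hkj j
      _ = (q / (q + 1 : ℝ) ^ 2) * (1 / 2 * N) ^ 2 := by
          simp only [Finset.sum_const, Finset.card_univ, Fintype.card_fin, nsmul_eq_mul]
          field_simp
      _ ≤ 1 * (1 / 2 * N) ^ 2 := by
          gcongr
          rw [div_le_one (by positivity)]
          nlinarith [(Nat.cast_nonneg q : (0 : ℝ) ≤ q)]
      _ = _ := one_mul _
  rw [Phi_zero_re]
  calc (1 / (2 * (q + 1 : ℝ))) ^ q * N ^ q = (N / (2 * (q + 1 : ℝ))) ^ q := by
        rw [← mul_pow]; congr 1; ring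
    _ ≤ (2 * (m : ℝ) + 1) ^ q := by
        have : (0 : ℝ) ≤ m := by exact_mod_cast hm0
        gcongr
        linarith
    _ = ∑ k ∈ freqCube q m, h (l2 k / N) := by
        rw [Finset.sum_congr rfl hone, ← card_freqCube q hm0]; simp
    _ ≤ _ := Finset.sum_le_sum_of_subset_of_nonneg hsub fun _ _ _ => hh.nonneg _

/-- The decay of the kernel away from the origin. -/
lemma exists_norm_Phi_mul_pow_le (q : ℕ) {h : ℝ → ℝ} (hh : SmoothCutoff h) (S : ℕ) :
    ∃ C : ℝ, ∀ N : ℝ, 1 ≤ N → ∀ x : Torus q, x ≠ 0 →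
      ‖Phi q h N x‖ * (N * ‖x‖) ^ S ≤ C * N ^ q := by
  obtain ⟨M, hM⟩ := hh.exists_norm_fwdDiff_le (EuclideanSpace ℝ (Fin q)) S
  refine ⟨(π / 2) ^ S * ((2 * S + 5) ^ q * M), fun N hN x hx => ?_⟩
  have hN0 : 0 < N := by linarith
  obtain ⟨j, hj⟩ : ∃ j, ‖x j‖ = ‖x‖ := by
    have hne : Nonempty (Fin q) := by
      by_contra hemp
      rw [not_nonempty_iff] at hemp
      exact hx (Subsingleton.elim _ _)
    obtain ⟨j, hj⟩ := Finite.exists_max fun j => ‖x j‖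
    exact ⟨j, le_antisymm (norm_le_pi_norm x j) ((pi_norm_le_iff_of_nonneg (norm_nonneg _)).mpr hj)⟩
  set g : EuclideanSpace ℝ (Fin q) → ℂ := fun y => ((h ‖y‖ : ℝ) : ℂ) with hg
  have hga : ∀ k, (g ∘ scaleHom q N) k = ((h (l2 k / N) : ℝ) : ℂ) := fun k => by
    simp [hg, norm_scaleHom hN0]
  have hsupp : ∀ k ∉ freqCube q ⌈N⌉, (g ∘ scaleHom q N) k = 0 := fun k hk => by
    rw [hga, hh.eq_zero_of_notMem_box hN0 hk, Complex.ofReal_zero]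
  have hB : ∀ k, ‖(fwdDiff (Pi.single j 1))^[S] (g ∘ scaleHom q N) k‖ ≤ M * (1 / N) ^ S := by
    intro k
    rw [fwdDiff_iterate_comp_addMonoidHom]
    have := hM (scaleHom q N (Pi.single j 1)) (scaleHom q N k)
    rwa [norm_scaleHom hN0, l2_single] at this
  have hM0 : 0 ≤ M * (1 / N) ^ S := (norm_nonneg _).trans (hB 0)
  have hc : (0 : ℤ) ≤ ⌈N⌉ := Int.ceil_nonneg hN0.le
  have hc' : (0 : ℝ) ≤ ⌈N⌉ := by exact_mod_cast hc
  have key := norm_pow_mul_norm_tsum_le j x S _ _ _ hc hsupp hB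
  have hPhi : ∑' k, (g ∘ scaleHom q N) k * eK k x = Phi q h N x := by
    rw [tsum_eq_sum (s := box q N) fun k hk => by rw [hsupp k hk, zero_mul], Phi_apply]
    exact Finset.sum_congr rfl fun k _ => by rw [hga]
  rw [hPhi] at key
  have hS0 : (S : ℝ) ≤ S * N := le_mul_of_one_le_right (Nat.cast_nonneg S) hN
  have hbd : (2 / π * ‖x‖) ^ S * ‖Phi q h N x‖
      ≤ ((2 * S + 5) * N) ^ q * (M * (1 / N) ^ S) := by
    calc _ ≤ ‖(fourier 1 (x j) : ℂ) - 1‖ ^ S * ‖Phi q h N x‖ := by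
          gcongr
          rw [← hj]
          exact two_div_pi_mul_norm_le (x j)
      _ ≤ _ := key
      _ ≤ _ := by
          gcongr
          linarith [(Int.ceil_lt_add_one N).le]
  calc ‖Phi q h N x‖ * (N * ‖x‖) ^ S
      = (π / 2) ^ S * N ^ S * ((2 / π * ‖x‖) ^ S * ‖Phi q h N x‖) := by
        have h1 : N * ‖x‖ = π / 2 * N * (2 / π * ‖x‖) := by
          have := pi_ne_zero
          field_simp
        rw [h1, mul_pow, mul_pow (π / 2)]
        ring
    _ ≤ (π / 2) ^ S * N ^ S * (((2 * S + 5) * N) ^ q * (M * (1 / N) ^ S)) := by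
        gcongr
    _ = (π / 2) ^ S * ((2 * S + 5) ^ q * M) * N ^ q * (N ^ S * (1 / N) ^ S) := by
        rw [mul_pow]; ring
    _ = _ := by
        rw [← mul_pow, mul_one_div_cancel hN0.ne', one_pow, mul_one]

/-- localization of the kernel `Φ_N`: for `N ≥ 1` and `x ∈ 𝕋^q`,
`|Φ_N(x)| ≤ Φ_N(0)`, `Φ_N(0) ≥ c₁ N^q`, `|Φ_N(x)| ≤ c₂ N^q / max(1, (N|x|)^S)`, and for `x ≠ 0`,
`|Φ_N(x)| ≤ c₂ N^q (N|x|)^{-S}`. -/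
theorem kernel_localization (q : ℕ) (h : ℝ → ℝ) (hh : SmoothCutoff h) (S : ℕ) (hS : q < S) :
    ∃ c₁ > 0, ∃ c₂ > 0, ∀ N : ℝ, 1 ≤ N → ∀ x : Torus q,
      (‖Phi q h N x‖ ≤ (Phi q h N 0).re ∧ c₁ * N ^ q ≤ (Phi q h N 0).re) ∧
      ‖Phi q h N x‖ ≤ c₂ * N ^ q / max 1 ((N * ‖x‖) ^ S) ∧
      (x ≠ 0 → ‖Phi q h N x‖ ≤ c₂ * N ^ q * ((N * ‖x‖) ^ S)⁻¹) := by
  obtain ⟨C, hC⟩ := exists_norm_Phi_mul_pow_le q hh S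
  refine ⟨(1 / (2 * (q + 1 : ℝ))) ^ q, by positivity, max (5 ^ q) C,
    lt_max_of_lt_left (by positivity), fun N hN x => ?_⟩
  have hN0 : 0 < N := by linarith
  have hNq : 0 < N ^ q := pow_pos hN0 q
  have h0 : ‖Phi q h N x‖ ≤ max (5 ^ q) C * N ^ q :=
    ((norm_Phi_le hh N x).trans (Phi_zero_le hh hN)).trans
      (mul_le_mul_of_nonneg_right (le_max_left _ _) hNq.le)
  have hdecay : x ≠ 0 → ‖Phi q h N x‖ * (N * ‖x‖) ^ S ≤ max (5 ^ q) C * N ^ q := fun hx =>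
    (hC N hN x hx).trans (mul_le_mul_of_nonneg_right (le_max_right _ _) hNq.le)
  refine ⟨⟨norm_Phi_le hh N x, le_Phi_zero hh hN⟩, ?_, fun hx => ?_⟩
  · rw [le_div_iff₀ (by positivity)]
    rcases max_choice 1 ((N * ‖x‖) ^ S) with hmax | hmax
    · rw [hmax, mul_one]
      exact h0
    · rw [hmax]
      rcases eq_or_ne x 0 with rfl | hx
      · simp only [norm_zero, mul_zero, zero_pow (Nat.ne_zero_of_lt hS)]
        positivity
      · exact hdecay hx
  · have hx0 : 0 < ‖x‖ := norm_pos_iff.mpr hx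
    rw [← div_eq_mul_inv, le_div_iff₀ (by positivity)]
    exact hdecay hx
end
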